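/- Let n ≥ 3 and δ ∈ (0,(n−1)/(n+1)). Let R(μ) denote the n-fold composition of the split-merge prerule Ř applied to μ. Then for every μ ∈ Δ^n_+ with μ_(1) = 1−δ, the entropy increase satisfies S(R(μ)) − S(μ) ≥ [1 − δ·(n+1)/(n−1)]·log 2 > 0, where S(x) = −Σ_{i=1}^n x_i log x_i. -/

import Mathlib

open scoped BigOperators

/-- The open unit simplex `Δ⁺ₙ`. -/
def simplexPos (n : ℕ) : Set (Fin n → ℝ) := {μ | (∀ i, 0 < μ i) ∧ ∑ i, μ i = 1}

/-- The permutation `p` ranking the components of `μ` in decreasing order,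
ties broken in increasing order of index (stable sort of `-μ`). -/
noncomputable def rankPerm {n : ℕ} (μ : Fin n → ℝ) : Equiv.Perm (Fin n) :=
  Tuple.sort (fun i => -μ i)

/-- The `k`-th reverse order statistic `μ₍ₖ₊₁₎` (0-indexed): `ordStat μ 0` is the
largest component, `ordStat μ (n-1)` the smallest. -/
noncomputable def ordStat {n : ℕ} (μ : Fin n → ℝ) (k : Fin n) : ℝ :=
  μ (rankPerm μ k)

/-- The split-merge prerule `Ř` with diversity parameter `δ`: if `μ₍₁₎ ≥ 1-δ`, the largest
company (rank 1) is split in half, the new half being placed at the index of rank `n-1`,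
whose previous two smallest values (ranks `n-1`, `n`) merge into the index of rank `n`;
otherwise (and when `n < 3`) it is the identity. -/
noncomputable def preRule {n : ℕ} (δ : ℝ) (μ : Fin n → ℝ) : Fin n → ℝ :=
  if hn : 3 ≤ n then
    if ordStat μ ⟨0, by omega⟩ < 1 - δ then μ
    else fun i =>
      if ((rankPerm μ).symm i : ℕ) = 0 then ordStat μ ⟨0, by omega⟩ / 2
      else if ((rankPerm μ).symm i : ℕ) = n - 2 then ordStat μ ⟨0, by omega⟩ / 2
      else if ((rankPerm μ).symm i : ℕ) = n - 1 then
        ordStat μ ⟨n - 1, by omega⟩ + ordStat μ ⟨n - 2, by omega⟩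
      else μ i
  else μ

/-- The entropy function `S(x) = -∑ xᵢ log xᵢ`. -/
noncomputable def entS {n : ℕ} (x : Fin n → ℝ) : ℝ := -∑ i, x i * Real.log (x i)

theorem ordStat_antitone {n : ℕ} (μ : Fin n → ℝ) : Antitone (ordStat μ) := fun _ _ hij =>
  neg_le_neg_iff.mp (Tuple.monotone_sort (fun i => -μ i) hij)

theorem sum_ordStat {n : ℕ} (φ : ℝ → ℝ) (μ : Fin n → ℝ) :
    ∑ k, φ (ordStat μ k) = ∑ i, φ (μ i) :=
  Equiv.sum_comp (rankPerm μ) fun i => φ (μ i)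

theorem preRule_of_lt {n : ℕ} (hn : 3 ≤ n) {δ : ℝ} {μ : Fin n → ℝ}
    (h : ordStat μ ⟨0, by omega⟩ < 1 - δ) : preRule δ μ = μ := by
  rw [preRule, dif_pos hn, if_pos h]

theorem preRule_rankPerm {n : ℕ} (hn : 3 ≤ n) {δ : ℝ} {μ : Fin n → ℝ}
    (h : 1 - δ ≤ ordStat μ ⟨0, by omega⟩) (k : Fin n) :
    preRule δ μ (rankPerm μ k) =
      if (k : ℕ) = 0 then ordStat μ ⟨0, by omega⟩ / 2
      else if (k : ℕ) = n - 2 then ordStat μ ⟨0, by omega⟩ / 2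
      else if (k : ℕ) = n - 1 then ordStat μ ⟨n - 1, by omega⟩ + ordStat μ ⟨n - 2, by omega⟩
      else ordStat μ k := by
  rw [preRule, dif_pos hn, if_neg (not_lt.mpr h)]
  simp only [Equiv.symm_apply_apply]
  rfl

/-- A split-merge changes a symmetric separable sum only through the ranks `1`, `n-1`, `n`. -/
theorem sum_preRule_sub {n : ℕ} (hn : 3 ≤ n) {δ : ℝ} {μ : Fin n → ℝ}
    (h : 1 - δ ≤ ordStat μ ⟨0, by omega⟩) (φ : ℝ → ℝ) :
    ∑ i, φ (preRule δ μ i) - ∑ i, φ (μ i) =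
      2 * φ (ordStat μ ⟨0, by omega⟩ / 2)
        + φ (ordStat μ ⟨n - 1, by omega⟩ + ordStat μ ⟨n - 2, by omega⟩)
        - φ (ordStat μ ⟨0, by omega⟩) - φ (ordStat μ ⟨n - 2, by omega⟩)
        - φ (ordStat μ ⟨n - 1, by omega⟩) := by
  rw [← Equiv.sum_comp (rankPerm μ) fun i => φ (preRule δ μ i), ← sum_ordStat φ μ,
    ← Finset.sum_sub_distrib]
  simp only [preRule_rankPerm hn h]
  have h₁ : (⟨0, by omega⟩ : Fin n) ∉ ({⟨n - 2, by omega⟩, ⟨n - 1, by omega⟩} : Finset (Fin n)) := by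
    simp only [Finset.mem_insert, Finset.mem_singleton, Fin.mk.injEq]; omega
  have h₂ : (⟨n - 2, by omega⟩ : Fin n) ∉ ({⟨n - 1, by omega⟩} : Finset (Fin n)) := by
    simp only [Finset.mem_singleton, Fin.mk.injEq]; omega
  rw [← Finset.sum_subset (Finset.subset_univ
    ({⟨0, by omega⟩, ⟨n - 2, by omega⟩, ⟨n - 1, by omega⟩} : Finset (Fin n))),
    Finset.sum_insert h₁, Finset.sum_insert h₂, Finset.sum_singleton]
  · have e₁ : n - 2 ≠ 0 := by omega
    have e₂ : n - 1 ≠ 0 := by omega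
    have e₃ : n - 1 ≠ n - 2 := by omega
    simp only [e₁, e₂, e₃, if_true, if_false]
    ring
  · intro k _ hk
    simp only [Finset.mem_insert, Finset.mem_singleton, Fin.ext_iff, not_or] at hk
    simp only [hk.1, hk.2.1, hk.2.2, if_false, sub_self]

theorem preRule_mem_simplexPos {n : ℕ} (hn : 3 ≤ n) (δ : ℝ) {μ : Fin n → ℝ}
    (hμ : μ ∈ simplexPos n) : preRule δ μ ∈ simplexPos n := by
  rcases lt_or_ge (ordStat μ ⟨0, by omega⟩) (1 - δ) with h | h
  · rwa [preRule_of_lt hn h]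
  · have hpos : ∀ k, 0 < ordStat μ k := fun k => hμ.1 _
    refine ⟨fun i => ?_, ?_⟩
    · obtain ⟨k, rfl⟩ := (rankPerm μ).surjective i
      rw [preRule_rankPerm hn h]
      split_ifs
      · exact half_pos (hpos _)
      · exact half_pos (hpos _)
      · exact add_pos (hpos _) (hpos _)
      · exact hpos _
    · have := sum_preRule_sub hn h id
      have hsum := hμ.2
      simp only [id] at this
      linarith

theorem ordStat_last_two_le {n : ℕ} (hn : 3 ≤ n) {μ : Fin n → ℝ} (hμ : ∑ i, μ i = 1) :
    ((n : ℝ) - 1) * (ordStat μ ⟨n - 1, by omega⟩ + ordStat μ ⟨n - 2, by omega⟩) ≤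
      2 * (1 - ordStat μ ⟨0, by omega⟩) := by
  set a := ordStat μ ⟨0, by omega⟩
  set x := ordStat μ ⟨n - 1, by omega⟩
  set y := ordStat μ ⟨n - 2, by omega⟩
  have hxy : x ≤ y := ordStat_antitone μ (Fin.mk_le_mk.mpr (by omega))
  have hn' : (3 : ℝ) ≤ n := by exact_mod_cast hn
  have hlow : ∑ k : Fin n, (y + (if k = ⟨0, by omega⟩ then a - y else 0)
      + (if k = ⟨n - 1, by omega⟩ then x - y else 0)) ≤ ∑ k, ordStat μ k := by
    refine Finset.sum_le_sum fun k _ => ?_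
    by_cases h₀ : k = ⟨0, by omega⟩
    · have h₁ : k ≠ ⟨n - 1, by omega⟩ := by
        rw [h₀, Ne, Fin.mk.injEq]; omega
      rw [if_pos h₀, if_neg h₁, h₀]; linarith
    · by_cases h₁ : k = ⟨n - 1, by omega⟩
      · rw [if_neg h₀, if_pos h₁, h₁]; linarith
      · rw [if_neg h₀, if_neg h₁, add_zero, add_zero]
        refine ordStat_antitone μ ?_
        rw [Fin.ext_iff] at h₁
        rw [Fin.le_def]
        have := k.isLt
        simp only at h₁ ⊢
        omega
  have hsum : ∑ k, ordStat μ k = 1 := (sum_ordStat id μ).trans hμ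
  rw [hsum, Finset.sum_add_distrib, Finset.sum_add_distrib, Finset.sum_ite_eq', Finset.sum_ite_eq']
    at hlow
  simp only [Finset.mem_univ, if_true, Finset.sum_const, Finset.card_univ, Fintype.card_fin,
    nsmul_eq_mul] at hlow
  nlinarith [mul_nonneg (sub_nonneg.mpr hn') (sub_nonneg.mpr hxy)]

theorem mul_log_add_le {x y : ℝ} (hx : 0 < x) (hy : 0 < y) :
    (x + y) * Real.log (x + y) ≤
      x * Real.log x + y * Real.log y + (x + y) * Real.log 2 := by
  have h := Real.convexOn_mul_log.2 (Set.mem_Ici.mpr hx.le) (Set.mem_Ici.mpr hy.le)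
    (by norm_num : (0 : ℝ) ≤ 1 / 2) (by norm_num : (0 : ℝ) ≤ 1 / 2) (by norm_num)
  simp only [smul_eq_mul] at h
  rw [show 1 / 2 * x + 1 / 2 * y = (x + y) / 2 by ring,
    Real.log_div (add_pos hx hy).ne' two_ne_zero] at h
  linarith

/-- Every effective split-merge increases the entropy by at least the claimed amount. -/
theorem le_entS_preRule_sub {n : ℕ} (hn : 3 ≤ n) {δ : ℝ} {μ : Fin n → ℝ} (hμ : μ ∈ simplexPos n)
    (h : 1 - δ ≤ ordStat μ ⟨0, by omega⟩) :
    (1 - δ * ((n : ℝ) + 1) / ((n : ℝ) - 1)) * Real.log 2 ≤ entS (preRule δ μ) - entS μ := by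
  have hn' : (3 : ℝ) ≤ n := by exact_mod_cast hn
  have hsum := sum_preRule_sub hn h fun t => t * Real.log t
  have hlast := ordStat_last_two_le hn hμ.2
  have hmerge := mul_log_add_le (hμ.1 (rankPerm μ ⟨n - 1, by omega⟩))
    (hμ.1 (rankPerm μ ⟨n - 2, by omega⟩))
  have ha : 0 < ordStat μ ⟨0, by omega⟩ := hμ.1 _
  simp only [← ordStat.eq_1] at hmerge
  simp only [Real.log_div ha.ne' two_ne_zero] at hsum
  set a := ordStat μ ⟨0, by omega⟩
  set x := ordStat μ ⟨n - 1, by omega⟩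
  set y := ordStat μ ⟨n - 2, by omega⟩
  have hcoef : 1 - δ * ((n : ℝ) + 1) / ((n : ℝ) - 1) ≤ a - (x + y) := by
    have hpos : (0 : ℝ) < n - 1 := by linarith
    have hxy : x + y ≤ 2 * δ / ((n : ℝ) - 1) := by
      rw [le_div_iff₀ hpos]; linarith
    have : δ * ((n : ℝ) + 1) / ((n : ℝ) - 1) = δ + 2 * δ / ((n : ℝ) - 1) := by
      field_simp; ring
    linarith
  have hmul := mul_le_mul_of_nonneg_right hcoef (Real.log_nonneg one_le_two)
  unfold entS
  linarith

theorem entS_le_entS_preRule_iterate {n : ℕ} (hn : 3 ≤ n) {δ : ℝ}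
    (hδ : 0 ≤ (1 - δ * ((n : ℝ) + 1) / ((n : ℝ) - 1)) * Real.log 2) (m : ℕ) {μ : Fin n → ℝ}
    (hμ : μ ∈ simplexPos n) : entS μ ≤ entS ((preRule δ)^[m] μ) := by
  induction m generalizing μ with
  | zero => exact le_rfl
  | succ m ih =>
    rw [Function.iterate_succ_apply]
    refine le_trans ?_ (ih (preRule_mem_simplexPos hn δ hμ))
    rcases lt_or_ge (ordStat μ ⟨0, by omega⟩) (1 - δ) with h | h
    · rw [preRule_of_lt hn h]
    · linarith [le_entS_preRule_sub hn hμ h]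

/-- For `n ≥ 3` and `δ ∈ (0,(n-1)/(n+1))`, the entropy increase under the
split-merge regulation rule `R` (the `n`-fold composition of the prerule `Ř`) satisfies
`S(R(μ)) - S(μ) ≥ (1 - δ(n+1)/(n-1))·log 2 > 0` for every boundary point `μ₍₁₎ = 1-δ`. -/
theorem entropy_increase_splitMerge_rule
    (n : ℕ) (hn : 3 ≤ n) (δ : ℝ)
    (hδ : δ ∈ Set.Ioo (0 : ℝ) (((n : ℝ) - 1) / ((n : ℝ) + 1)))
    (μ : Fin n → ℝ) (hμ : μ ∈ simplexPos n)
    (htop : ordStat μ ⟨0, by omega⟩ = 1 - δ) :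
    (1 - δ * ((n : ℝ) + 1) / ((n : ℝ) - 1)) * Real.log 2 ≤ entS ((preRule δ)^[n] μ) - entS μ ∧
      0 < (1 - δ * ((n : ℝ) + 1) / ((n : ℝ) - 1)) * Real.log 2 := by
  have hn' : (3 : ℝ) ≤ n := by exact_mod_cast hn
  have hc : 0 < (1 - δ * ((n : ℝ) + 1) / ((n : ℝ) - 1)) * Real.log 2 := by
    refine mul_pos ?_ (Real.log_pos one_lt_two)
    have := hδ.2
    rw [lt_div_iff₀ (by linarith)] at this
    rw [sub_pos, div_lt_one (by linarith)]
    exact this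
  refine ⟨?_, hc⟩
  obtain ⟨m, hm⟩ : ∃ m, n = m + 1 := ⟨n - 1, by omega⟩
  have hstep := le_entS_preRule_sub hn hμ htop.ge
  have hiter := entS_le_entS_preRule_iterate hn hc.le m (preRule_mem_simplexPos hn δ hμ)
  rw [← Function.iterate_succ_apply, Nat.succ_eq_add_one, ← hm] at hiter
  linarith
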